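/- Let D be a PvMD in which every t-maximal ideal is t-sharp inside D. If I is a nonzero ideal of D with (D : I) = D, then I is t-idempotent, i.e., (I²)^t = I^t. -/

import Mathlib

/-! Statement 11: Let D be a PvMD in which every t-maximal ideal is t-sharp. If I is a nonzero ideal with (D : I) = D, then I is t-idempotent. -/

noncomputable section

/-- The image of an ideal of `D` in the fraction field of `D`, as a `D`-submodule. -/
def coeI (D : Type*) [CommRing D] [IsDomain D] (I : Ideal D) :
    Submodule D (FractionRing D) :=
  Submodule.map (Algebra.linearMap D (FractionRing D)) I

/-- The `v`-operation on `D`-submodules of the fraction field `K`: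
`E^v = (E⁻¹)⁻¹`, where `E⁻¹ = (D : E) = {x ∈ K : xE ⊆ D}`. -/
def vSub (D : Type*) [CommRing D] [IsDomain D] (E : Submodule D (FractionRing D)) :
    Submodule D (FractionRing D) :=
  1 / (1 / E)

/-- The `t`-operation: `E^t = ⋃ {F^v : F` a nonzero finitely generated submodule `⊆ E}`,
as a subset of the fraction field. -/
def tSet (D : Type*) [CommRing D] [IsDomain D] (E : Submodule D (FractionRing D)) :
    Set (FractionRing D) :=
  ⋃ F ∈ {F : Submodule D (FractionRing D) | F.FG ∧ F ≠ ⊥ ∧ F ≤ E},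
    (vSub D F : Set (FractionRing D))

/-- An integral ideal `I` of `D` is a `t`-ideal if `I^t = I`. -/
def IsTIdeal (D : Type*) [CommRing D] [IsDomain D] (I : Ideal D) : Prop :=
  tSet D (coeI D I) = (coeI D I : Set (FractionRing D))

/-- A nonzero ideal `I` of `D` is `t`-idempotent if `(I²)^t = I^t`. -/
def TIdem (D : Type*) [CommRing D] [IsDomain D] (I : Ideal D) : Prop :=
  tSet D (coeI D (I * I)) = tSet D (coeI D I)

/-- `D` is a Prüfer `v`-multiplication domain: `(F·F⁻¹)^t = D` for every nonzero
finitely generated ideal `F` of `D`. -/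
def IsPvMD (D : Type*) [CommRing D] [IsDomain D] : Prop :=
  ∀ F : Ideal D, F ≠ ⊥ → F.FG →
    tSet D (coeI D F * (1 / coeI D F)) =
      ((1 : Submodule D (FractionRing D)) : Set (FractionRing D))

/-- A `t`-maximal ideal: an ideal maximal among proper integral `t`-ideals. -/
def IsTMax (D : Type*) [CommRing D] [IsDomain D] (M : Ideal D) : Prop :=
  M ≠ ⊤ ∧ IsTIdeal D M ∧ ∀ J : Ideal D, J ≠ ⊤ → IsTIdeal D J → M ≤ J → J = M

/-- The localization `D_P` of `D` at a prime `P`, viewed as a subset of the fraction field: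
the set of fractions `a / s` with `s ∉ P`. -/
def locSet (D : Type*) [CommRing D] [IsDomain D] (P : Ideal D) : Set (FractionRing D) :=
  {x | ∃ a s : D, s ∉ P ∧ x * algebraMap D (FractionRing D) s = algebraMap D (FractionRing D) a}

/-- A prime `t`-ideal `P` is `t`-sharp if `⋂ {D_M : M t-maximal, M ⊉ P} ⊄ D_P`. -/
def IsTSharp (D : Type*) [CommRing D] [IsDomain D] (P : Ideal D) : Prop :=
  ¬ (⋂ M ∈ {M : Ideal D | IsTMax D M ∧ ¬ P ≤ M}, locSet D M) ⊆ locSet D P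

/-- A prime ideal `P` of `D` is branched if there is a `P`-primary ideal distinct from `P`. -/
def IsBranched (D : Type*) [CommRing D] [IsDomain D] (P : Ideal D) : Prop :=
  ∃ Q : Ideal D, Q.IsPrimary ∧ Q.radical = P ∧ Q ≠ P

/-- `D` has finite `t`-character: every nonzero element lies in only finitely many
`t`-maximal ideals. -/
def FiniteTCharacter (D : Type*) [CommRing D] [IsDomain D] : Prop :=
  ∀ a : D, a ≠ 0 → {M : Ideal D | IsTMax D M ∧ a ∈ M}.Finite

/-- A nonzero ideal `I` of `D` is divisorial if `(I⁻¹)⁻¹ = I`. -/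
def IsDivisorial (D : Type*) [CommRing D] [IsDomain D] (I : Ideal D) : Prop :=
  vSub D (coeI D I) = coeI D I


section TOperation

variable {D : Type*} [CommRing D]

/-- The ideal `{d ∈ D : d y ∈ D}` of denominators of an element `y` of the fraction field. -/
def denomIdeal (y : FractionRing D) : Ideal D :=
  (1 : Submodule D (FractionRing D)).comap (LinearMap.toSpanSingleton D (FractionRing D) y)

lemma mem_denomIdeal {y : FractionRing D} {d : D} :
    d ∈ denomIdeal y ↔
      ∃ e : D, algebraMap D (FractionRing D) e = algebraMap D (FractionRing D) d * y := by
  simp [denomIdeal, Submodule.mem_one, Algebra.smul_def]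

/-- A finitely generated ideal below `C ⊔ (d)` lies below `C' ⊔ (d)` for some finitely generated
`C' ≤ C`. -/
lemma exists_fg_le_sup_span {C G : Ideal D} {d : D} (hG : G.FG) (h : G ≤ C ⊔ Ideal.span {d}) :
    ∃ C' : Ideal D, C'.FG ∧ C' ≤ C ∧ G ≤ C' ⊔ Ideal.span {d} := by
  induction G, hG using Submodule.fg_induction with
  | singleton g =>
    obtain ⟨c, hc, e, he, hce⟩ := Submodule.mem_sup.1 (h (Submodule.mem_span_singleton_self g))
    refine ⟨Ideal.span {c}, Submodule.fg_span_singleton c,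
      (Ideal.span_singleton_le_iff_mem C).2 hc, (Ideal.span_singleton_le_iff_mem _).2 ?_⟩
    rw [← hce]
    exact Submodule.add_mem_sup (Ideal.mem_span_singleton_self c) he
  | sup G₁ G₂ _ _ ih₁ ih₂ =>
    obtain ⟨C₁, hf₁, hC₁, hG₁⟩ := ih₁ (le_sup_left.trans h)
    obtain ⟨C₂, hf₂, hC₂, hG₂⟩ := ih₂ (le_sup_right.trans h)
    exact ⟨C₁ ⊔ C₂, Submodule.FG.sup hf₁ hf₂, sup_le hC₁ hC₂,
      sup_le (hG₁.trans (sup_le_sup_right le_sup_left _))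
        (hG₂.trans (sup_le_sup_right le_sup_right _))⟩

variable [IsDomain D]

lemma mem_coeI {I : Ideal D} {d : D} :
    algebraMap D (FractionRing D) d ∈ coeI D I ↔ d ∈ I := by
  constructor
  · rintro ⟨e, he, h⟩
    rwa [← IsFractionRing.injective D (FractionRing D) h]
  · exact fun h => ⟨d, h, rfl⟩

lemma coeI_ne_bot {I : Ideal D} (hI : I ≠ ⊥) : coeI D I ≠ ⊥ := by
  obtain ⟨b, hb, hb0⟩ := Submodule.exists_mem_ne_zero_of_ne_bot hI
  intro h
  have := mem_coeI.2 hb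
  rw [h, Submodule.mem_bot] at this
  exact hb0 (by simpa using this)

lemma mem_one_div_coeI {I : Ideal D} {y : FractionRing D} :
    y ∈ 1 / coeI D I ↔ I ≤ denomIdeal y := by
  rw [Submodule.mem_div_iff_forall_mul_mem]
  constructor
  · intro h d hd
    obtain ⟨e, he⟩ := Submodule.mem_one.1 (h _ (mem_coeI.2 hd))
    exact mem_denomIdeal.2 ⟨e, by rw [he, mul_comm]⟩
  · rintro h _ ⟨d, hd, rfl⟩
    obtain ⟨e, he⟩ := mem_denomIdeal.1 (h hd)
    exact Submodule.mem_one.2 ⟨e, by rw [he, mul_comm]; rfl⟩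

lemma mem_vSub {E : Submodule D (FractionRing D)} {x : FractionRing D} :
    x ∈ vSub D E ↔ ∀ y ∈ 1 / E, x * y ∈ (1 : Submodule D (FractionRing D)) :=
  Iff.rfl

lemma algebraMap_mem_vSub_coeI {F : Ideal D} {d : D} :
    algebraMap D (FractionRing D) d ∈ vSub D (coeI D F) ↔
      ∀ y : FractionRing D, F ≤ denomIdeal y → d ∈ denomIdeal y := by
  simp only [mem_vSub, mem_one_div_coeI, Submodule.mem_one, mem_denomIdeal]

lemma mem_tSet {E : Submodule D (FractionRing D)} {x : FractionRing D} :
    x ∈ tSet D E ↔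
      ∃ F : Submodule D (FractionRing D), (F.FG ∧ F ≠ ⊥ ∧ F ≤ E) ∧ x ∈ vSub D F := by
  simp [tSet]

lemma tSet_mono {E E' : Submodule D (FractionRing D)} (h : E ≤ E') : tSet D E ⊆ tSet D E' := by
  intro x hx
  obtain ⟨F, ⟨h1, h2, h3⟩, hF⟩ := mem_tSet.1 hx
  exact mem_tSet.2 ⟨F, ⟨h1, h2, h3.trans h⟩, hF⟩

lemma exists_eq_coeI {C : Ideal D} {F : Submodule D (FractionRing D)} (hfg : F.FG)
    (hF0 : F ≠ ⊥) (hF : F ≤ coeI D C) :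
    ∃ F' : Ideal D, F'.FG ∧ F' ≠ ⊥ ∧ F' ≤ C ∧ F = coeI D F' := by
  have heq : F = coeI D (F.comap (Algebra.linearMap D (FractionRing D))) := by
    rw [coeI, Submodule.map_comap_eq_self]
    exact hF.trans (LinearMap.map_le_range)
  refine ⟨F.comap (Algebra.linearMap D (FractionRing D)), ?_, ?_, ?_, heq⟩
  · refine Submodule.fg_of_fg_map_injective (Algebra.linearMap D (FractionRing D))
      (IsFractionRing.injective D (FractionRing D)) ?_
    rw [coeI] at heq
    rwa [← heq]
  · intro h
    rw [h, coeI, Submodule.map_bot] at heq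
    exact hF0 heq
  · intro d hd
    exact mem_coeI.1 (hF hd)

lemma coeI_fg {F : Ideal D} (h : F.FG) : (coeI D F).FG := Submodule.FG.map _ h

lemma IsTIdeal.mem {C F : Ideal D} (hC : IsTIdeal D C) (hfg : F.FG) (hF0 : F ≠ ⊥) (hF : F ≤ C)
    {d : D} (hd : ∀ y : FractionRing D, F ≤ denomIdeal y → d ∈ denomIdeal y) : d ∈ C := by
  rw [← mem_coeI, ← SetLike.mem_coe, ← hC, mem_tSet]
  exact ⟨coeI D F, ⟨coeI_fg hfg, coeI_ne_bot hF0, Submodule.map_mono hF⟩,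
    algebraMap_mem_vSub_coeI.2 hd⟩

lemma isTIdeal_of_forall {C : Ideal D} (hC0 : C ≠ ⊥)
    (h : ∀ F : Ideal D, F.FG → F ≠ ⊥ → F ≤ C → ∀ d : D,
      (∀ y : FractionRing D, F ≤ denomIdeal y → d ∈ denomIdeal y) → d ∈ C) : IsTIdeal D C := by
  apply Set.Subset.antisymm
  · intro x hx
    obtain ⟨F, ⟨h1, h2, h3⟩, hxF⟩ := mem_tSet.1 hx
    obtain ⟨F, hfg, hF0, hFC, rfl⟩ := exists_eq_coeI h1 h2 h3
    have h1 : (1 : FractionRing D) ∈ 1 / coeI D F := by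
      rw [mem_one_div_coeI]
      exact fun d _ => mem_denomIdeal.2 ⟨d, by simp⟩
    obtain ⟨d, hd⟩ := Submodule.mem_one.1 (mem_vSub.1 hxF 1 h1)
    rw [mul_one] at hd
    rw [← hd] at hxF ⊢
    exact mem_coeI.2 (h F hfg hF0 hFC d (algebraMap_mem_vSub_coeI.1 hxF))
  · rintro _ ⟨d, hd, rfl⟩
    obtain ⟨b, hb, hb0⟩ := Submodule.exists_mem_ne_zero_of_ne_bot hC0
    refine mem_tSet.2 ⟨coeI D (Ideal.span {d, b}), ⟨coeI_fg (Submodule.fg_span (Set.toFinite _)),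
      coeI_ne_bot ?_, Submodule.map_mono ?_⟩, algebraMap_mem_vSub_coeI.2 fun y hy => hy ?_⟩
    · intro h
      rw [Ideal.span_eq_bot] at h
      exact hb0 (h b (by simp))
    · rw [Ideal.span_le]
      rintro e (rfl | rfl)
      exacts [hd, hb]
    · exact Ideal.subset_span (by simp)

lemma IsTIdeal.ne_bot {C : Ideal D} (hC : IsTIdeal D C) : C ≠ ⊥ := by
  rintro rfl
  have h : (0 : FractionRing D) ∈ tSet D (coeI D ⊥) := by
    rw [hC]
    exact (coeI D ⊥).zero_mem
  obtain ⟨F, ⟨-, h2, h3⟩, -⟩ := mem_tSet.1 h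
  rw [coeI, Submodule.map_bot, le_bot_iff] at h3
  exact h2 h3

/-- A nonzero ideal contained in no `t`-maximal ideal contains a nonzero finitely generated
ideal `G` with `(D : G) = D`. -/
lemma exists_fg_of_forall_not_le {B : Ideal D} (hB : B ≠ ⊥)
    (h : ∀ M : Ideal D, IsTMax D M → ¬ B ≤ M) :
    ∃ G : Ideal D, G.FG ∧ G ≠ ⊥ ∧ G ≤ B ∧
      ∀ y : FractionRing D, G ≤ denomIdeal y → 1 ∈ denomIdeal y := by
  by_contra! hne
  have key : ∀ G : Ideal D, G.FG → G ≤ B →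
      ¬ ∀ y : FractionRing D, G ≤ denomIdeal y → 1 ∈ denomIdeal y := by
    intro G hG hGB hy
    obtain ⟨b, hb, hb0⟩ := Submodule.exists_mem_ne_zero_of_ne_bot hB
    obtain ⟨y, hy1, hy2⟩ := hne (G ⊔ Ideal.span {b}) (Submodule.FG.sup hG (Submodule.fg_span_singleton b))
      (fun h0 => hb0 (by simpa using (sup_eq_bot_iff.1 h0).2))
      (sup_le hGB ((Ideal.span_singleton_le_iff_mem B).2 hb))
    exact hy2 (hy y (le_sup_left.trans hy1))
  obtain ⟨C, hBC, hC⟩ := zorn_le_nonempty₀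
    {C : Ideal D | ∀ G : Ideal D, G.FG → G ≤ C →
      ¬ ∀ y : FractionRing D, G ≤ denomIdeal y → 1 ∈ denomIdeal y}
    (by
      intro c hc hchain C hCc
      refine ⟨sSup c, ?_, fun _ => le_sSup⟩
      intro G hG hGc
      obtain ⟨C', hC', hGC'⟩ :=
        (CompleteLattice.isCompactElement_iff_le_of_directed_sSup_le _ _).1
          ((Submodule.fg_iff_compact G).1 hG) c ⟨C, hCc⟩ hchain.directedOn hGc
      exact hc hC' G hG hGC') B key
  have hC0 : C ≠ ⊥ := fun h0 => hB (le_bot_iff.1 (h0 ▸ hBC))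
  refine h C ⟨?_, isTIdeal_of_forall hC0 ?_, ?_⟩ hBC
  · rintro rfl
    exact hC.prop ⊤ Module.Finite.fg_top le_rfl fun y hy => hy trivial
  · intro F hF hF0 hFC d hd
    by_contra hdC
    have hlt : ¬ ∀ G : Ideal D, G.FG → G ≤ C ⊔ Ideal.span {d} →
        ¬ ∀ y : FractionRing D, G ≤ denomIdeal y → 1 ∈ denomIdeal y := by
      intro hmem
      exact hdC (hC.le_of_ge hmem le_sup_left
        (Ideal.mem_sup_right (Ideal.mem_span_singleton_self d)))
    push Not at hlt
    obtain ⟨G, hG, hGC, hG1⟩ := hlt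
    obtain ⟨C', hf', hC', hGC'⟩ := exists_fg_le_sup_span hG hGC
    refine hC.prop (C' ⊔ F) (Submodule.FG.sup hf' hF) (sup_le hC' hFC) fun y hy => hG1 y (hGC'.trans ?_)
    exact sup_le (le_sup_left.trans hy)
      ((Ideal.span_singleton_le_iff_mem _).2 (hd y (le_sup_right.trans hy)))
  · intro J hJ hJt hCJ
    refine le_antisymm (hC.le_of_ge ?_ hCJ) hCJ
    intro G hG hGJ hG1
    obtain ⟨b, hb, hb0⟩ := Submodule.exists_mem_ne_zero_of_ne_bot hJt.ne_bot
    refine hJ ((Ideal.eq_top_iff_one J).2 (hJt.mem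
      (Submodule.FG.sup hG (Submodule.fg_span_singleton b)) ?_
      (sup_le hGJ ((Ideal.span_singleton_le_iff_mem J).2 hb))
      fun y hy => hG1 y (le_sup_left.trans hy)))
    exact fun h0 => hb0 (by simpa using (sup_eq_bot_iff.1 h0).2)

lemma IsTMax.isPrime {M : Ideal D} (hM : IsTMax D M) : M.IsPrime := by
  refine ⟨hM.1, fun {a b} hab => or_iff_not_imp_left.2 fun ha => ?_⟩
  have ha0 : a ≠ 0 := fun h => ha (h ▸ M.zero_mem)
  have hmem : ∀ d, d ∈ Submodule.comap (LinearMap.mulLeft D a) M ↔ a * d ∈ M := fun d => Iff.rfl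
  have hle : M ≤ Submodule.comap (LinearMap.mulLeft D a) M := fun d hd => M.mul_mem_left a hd
  have heq : Submodule.comap (LinearMap.mulLeft D a) M = M := by
    refine hM.2.2 _ ?_ (isTIdeal_of_forall ?_ ?_) hle
    · intro h
      have h1 : (1 : D) ∈ Submodule.comap (LinearMap.mulLeft D a) M := h ▸ trivial
      exact ha (by simpa using h1)
    · exact fun h => hM.2.1.ne_bot (le_bot_iff.1 (h ▸ hle))
    · intro F hF hF0 hFM d hd
      rw [hmem]
      refine hM.2.1.mem (F := Submodule.map (LinearMap.mulLeft D a) F) (Submodule.FG.map _ hF) ?_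
        (Submodule.map_le_iff_le_comap.2 hFM) ?_
      · intro h
        obtain ⟨f, hf, hf0⟩ := Submodule.exists_mem_ne_zero_of_ne_bot hF0
        have : a * f ∈ Submodule.map (LinearMap.mulLeft D a) F := ⟨f, hf, rfl⟩
        rw [h] at this
        exact mul_ne_zero ha0 hf0 (by simpa using this)
      · intro y hy
        have hF' : F ≤ denomIdeal (algebraMap D (FractionRing D) a * y) := by
          intro f hf
          obtain ⟨e, he⟩ := mem_denomIdeal.1 (hy ⟨f, hf, rfl⟩)
          refine mem_denomIdeal.2 ⟨e, he.trans ?_⟩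
          simp only [LinearMap.mulLeft_apply, map_mul]
          ring
        obtain ⟨e, he⟩ := mem_denomIdeal.1 (hd _ hF')
        refine mem_denomIdeal.2 ⟨e, he.trans ?_⟩
        rw [map_mul]
        ring
  rw [← heq]
  exact hab

/-- `D` is the intersection of its localizations at `t`-maximal ideals. -/
lemma mem_range_of_forall_mem_locSet {x : FractionRing D}
    (h : ∀ M : Ideal D, IsTMax D M → x ∈ locSet D M) :
    ∃ d : D, algebraMap D (FractionRing D) d = x := by
  have hne : denomIdeal x ≠ ⊥ := by
    obtain ⟨p, q, hq, hx⟩ := IsFractionRing.div_surjective (A := D) x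
    have hq0 : algebraMap D (FractionRing D) q ≠ 0 := by
      simpa using nonZeroDivisors.ne_zero hq
    intro h0
    have : q ∈ denomIdeal x := mem_denomIdeal.2 ⟨p, by rw [← hx]; field_simp⟩
    rw [h0] at this
    exact nonZeroDivisors.ne_zero hq (by simpa using this)
  obtain ⟨G, -, -, hG, hG1⟩ := exists_fg_of_forall_not_le hne (by
    intro M hM hle
    obtain ⟨a, s, hs, hx⟩ := h M hM
    exact hs (hle (mem_denomIdeal.2 ⟨a, by rw [← hx, mul_comm]⟩)))
  obtain ⟨e, he⟩ := mem_denomIdeal.1 (hG1 x hG)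
  exact ⟨e, by simpa using he⟩

/-- Localizations of a PvMD at `t`-maximal ideals are valuation domains. -/
lemma IsPvMD.exists_mul_eq_mul (hD : IsPvMD D) {M : Ideal D} (hM : IsTMax D M) (p q : D) :
    ∃ a b : D, a * q = b * p ∧ (a ∉ M ∨ b ∉ M) := by
  by_cases h0 : p = 0 ∧ q = 0
  · exact ⟨1, 1, by rw [h0.1, h0.2], Or.inl ((Ideal.ne_top_iff_one M).1 hM.1)⟩
  by_contra! hcon
  set F : Ideal D := Ideal.span {p, q} with hFdef
  have hF0 : F ≠ ⊥ := by
    intro h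
    rw [hFdef, Ideal.span_eq_bot] at h
    exact h0 ⟨h p (by simp), h q (by simp)⟩
  have hle : coeI D F * (1 / coeI D F) ≤ coeI D M := by
    rw [Submodule.mul_le]
    rintro _ ⟨f, hf, rfl⟩ y hy
    rw [mem_one_div_coeI] at hy
    obtain ⟨a, ha⟩ := mem_denomIdeal.1 (hy (Ideal.subset_span (by simp : p ∈ ({p, q} : Set D))))
    obtain ⟨b, hb⟩ := mem_denomIdeal.1 (hy (Ideal.subset_span (by simp : q ∈ ({p, q} : Set D))))
    have hab : a * q = b * p := by
      apply IsFractionRing.injective D (FractionRing D)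
      rw [map_mul, map_mul, ha, hb]
      ring
    obtain ⟨haM, hbM⟩ := hcon a b hab
    obtain ⟨u, v, rfl⟩ := Ideal.mem_span_pair.1 hf
    refine ⟨u * a + v * b, M.add_mem (M.mul_mem_left u haM)
      (M.mul_mem_left v hbM), ?_⟩
    simp only [Algebra.linearMap_apply, map_add, map_mul, ha, hb]
    ring
  have h1 : algebraMap D (FractionRing D) 1 ∈ tSet D (coeI D M) := by
    refine tSet_mono hle ?_
    rw [hD F hF0 (Submodule.fg_span (Set.toFinite _))]
    exact Submodule.mem_one.2 ⟨1, rfl⟩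
  rw [hM.2.1] at h1
  exact hM.1 ((Ideal.eq_top_iff_one M).2 (mem_coeI.1 h1))

/-- If `I` is not idempotent locally at a `t`-maximal ideal `M`, then `I` is locally contained in
a proper principal ideal. -/
lemma IsPvMD.exists_forall_mul_eq_mul (hD : IsPvMD D) {M : Ideal D} (hM : IsTMax D M)
    {I : Ideal D} {a : D} (ha : a ∈ I) (hna : ∀ s ∉ M, s * a ∉ I * I) :
    ∃ z ∈ M, ∀ c ∈ I, ∃ s ∉ M, ∃ t : D, s * c = t * z := by
  have hprime := hM.isPrime
  have hmul : ∀ {s t : D}, s ∉ M → t ∉ M → s * t ∉ M := fun hs ht h =>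
    (hprime.mem_or_mem h).elim hs ht
  have h1M : (1 : D) ∉ M := (Ideal.ne_top_iff_one M).1 hM.1
  by_cases hall : ∀ b ∈ I, ∃ s ∉ M, ∃ t : D, s * b = t * a
  · refine ⟨a, ?_, hall⟩
    by_contra haM
    exact hna a haM (Ideal.mul_mem_mul ha ha)
  push Not at hall
  obtain ⟨b, hb, hba⟩ := hall
  obtain ⟨t, s, hst, h⟩ := hD.exists_mul_eq_mul hM a b
  have htM : t ∈ M := by
    by_contra htM
    exact hba t htM s hst
  have hsM : s ∉ M := h.resolve_left (not_not.2 htM)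
  have hb0 : b ≠ 0 := by
    rintro rfl
    exact hba 1 h1M 0 (by simp)
  refine ⟨t, htM, fun c hc => ?_⟩
  obtain ⟨u, v, huv, h'⟩ := hD.exists_mul_eq_mul hM a (b * c)
  have huM : u ∉ M := by
    intro huM
    refine hna v (h'.resolve_left (not_not.2 huM)) ?_
    rw [← huv]
    exact Ideal.mul_mem_left _ _ (Ideal.mul_mem_mul hb hc)
  refine ⟨s * u, hmul hsM huM, v, mul_left_cancel₀ hb0 ?_⟩
  linear_combination s * huv - v * hst

/-- Over a PvMD, an ideal with trivial inverse is locally idempotent at each `t`-sharp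
`t`-maximal ideal. -/
lemma IsTSharp.exists_mul_mem (hD : IsPvMD D) {M : Ideal D} (hM : IsTMax D M)
    (hsharp : IsTSharp D M) {I : Ideal D}
    (hinv : (1 : Submodule D (FractionRing D)) / coeI D I = 1) {a : D} (ha : a ∈ I) :
    ∃ s ∉ M, s * a ∈ I * I := by
  by_contra! hna
  obtain ⟨z, hz, hIz⟩ := hD.exists_forall_mul_eq_mul hM ha hna
  obtain ⟨x, hx, hxM⟩ := Set.not_subset.1 hsharp
  simp only [Set.mem_iInter, Set.mem_ofPred_eq, and_imp] at hx
  have h1M : (1 : D) ∉ M := (Ideal.ne_top_iff_one M).1 hM.1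
  -- an element of all the other localizations that multiplies `I` into `D_M` lies in `D`
  have key : ∀ (w : FractionRing D) (b r e : D), b ∉ M →
      algebraMap D (FractionRing D) r * x = w →
      algebraMap D (FractionRing D) b * w * algebraMap D (FractionRing D) z
        = algebraMap D (FractionRing D) e →
      ∃ d : D, algebraMap D (FractionRing D) d = w := by
    intro w b r e hb hr he
    have hw : w ∈ 1 / coeI D I := by
      rw [Submodule.mem_div_iff_forall_mul_mem]
      rintro _ ⟨c, hc, rfl⟩
      refine Submodule.mem_one.2 (mem_range_of_forall_mem_locSet fun N hN => ?_)
      simp only [Algebra.linearMap_apply]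
      by_cases hMN : M ≤ N
      · obtain rfl : N = M := hM.2.2 N hN.1 hN.2.1 hMN
        obtain ⟨s, hs, t, hst⟩ := hIz c hc
        refine ⟨t * e, s * b, fun h => (hM.isPrime.mem_or_mem h).elim hs hb, ?_⟩
        have hst' := congrArg (algebraMap D (FractionRing D)) hst
        rw [map_mul, map_mul] at hst'
        rw [map_mul, map_mul]
        linear_combination (algebraMap D (FractionRing D) b * w) * hst' +
          algebraMap D (FractionRing D) t * he
      · obtain ⟨p, s, hs, hp⟩ := hx N hN hMN
        refine ⟨r * p * c, s, hs, ?_⟩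
        rw [← hr, map_mul, map_mul, ← hp]
        ring
    rw [hinv] at hw
    exact Submodule.mem_one.1 hw
  obtain ⟨p, q, hq, hpq⟩ := IsFractionRing.div_surjective (A := D) x
  have hq0 : algebraMap D (FractionRing D) q ≠ 0 := by
    simpa using nonZeroDivisors.ne_zero hq
  obtain ⟨e, b, heb, h⟩ := hD.exists_mul_eq_mul hM (z * p) q
  have hbx : algebraMap D (FractionRing D) b * x * algebraMap D (FractionRing D) z
      = algebraMap D (FractionRing D) e := by
    have heb' := congrArg (algebraMap D (FractionRing D)) heb
    simp only [map_mul] at heb'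
    rw [← hpq]
    field_simp
    linear_combination -heb'
  by_cases heM : e ∈ M
  · obtain ⟨d, hd⟩ := key x b 1 e (h.resolve_left (not_not.2 heM)) (by simp) hbx
    exact hxM ⟨d, 1, h1M, by rw [map_one, mul_one, hd]⟩
  · obtain ⟨d, hd⟩ := key _ 1 b e h1M rfl (by rw [map_one, one_mul, hbx])
    refine heM ?_
    have : d * z = e := by
      apply IsFractionRing.injective D (FractionRing D)
      rw [map_mul, hd, hbx]
    rw [← this]
    exact M.mul_mem_left d hz

/-- An ideal that is idempotent locally at all `t`-maximal ideals is `t`-idempotent. -/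
lemma TIdem.of_forall_exists_mul_mem {I : Ideal D} (hI : I ≠ ⊥)
    (h : ∀ M : Ideal D, IsTMax D M → ∀ a ∈ I, ∃ s ∉ M, s * a ∈ I * I) : TIdem D I := by
  refine Set.Subset.antisymm (tSet_mono (Submodule.map_mono Ideal.mul_le_right)) fun x hx => ?_
  obtain ⟨F, ⟨h1, h2, h3⟩, hxF⟩ := mem_tSet.1 hx
  obtain ⟨F, hfg, hF0, hFI, rfl⟩ := exists_eq_coeI h1 h2 h3
  have hIB : I ≤ (I * I).colon (F : Set D) := fun d hd =>
    Submodule.mem_colon.2 fun f hf => Ideal.mul_mem_mul hd (hFI hf)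
  obtain ⟨G, hG, hG0, hGB, hG1⟩ := exists_fg_of_forall_not_le
    (fun h0 => hI (le_bot_iff.1 (h0 ▸ hIB)) : (I * I).colon (F : Set D) ≠ ⊥) (by
    intro M hM hle
    have hloc : ∃ s ∉ M, ∀ f ∈ F, s * f ∈ I * I := by
      clear hle hIB hxF hx h1 h2 h3 hF0
      induction F, hfg using Submodule.fg_induction with
      | singleton f =>
        obtain ⟨s, hs, hsf⟩ := h M hM f (hFI (Submodule.mem_span_singleton_self f))
        refine ⟨s, hs, fun g hg => ?_⟩
        obtain ⟨r, rfl⟩ := Submodule.mem_span_singleton.1 hg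
        rw [smul_eq_mul, mul_left_comm]
        exact Ideal.mul_mem_left _ r hsf
      | sup F₁ F₂ _ _ ih₁ ih₂ =>
        obtain ⟨s, hs, hs'⟩ := ih₁ (le_sup_left.trans hFI)
        obtain ⟨t, ht, ht'⟩ := ih₂ (le_sup_right.trans hFI)
        refine ⟨s * t, fun hst => (hM.isPrime.mem_or_mem hst).elim hs ht, fun f hf => ?_⟩
        obtain ⟨f₁, hf₁, f₂, hf₂, rfl⟩ := Submodule.mem_sup.1 hf
        have := Ideal.add_mem _ (Ideal.mul_mem_left _ t (hs' f₁ hf₁))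
          (Ideal.mul_mem_left _ s (ht' f₂ hf₂))
        convert this using 1
        ring
    obtain ⟨s, hs, hsF⟩ := hloc
    exact hs (hle (Submodule.mem_colon.2 hsF)))
  refine mem_tSet.2 ⟨coeI D (G * F), ⟨coeI_fg (Submodule.FG.mul hG hfg), coeI_ne_bot (mul_ne_zero hG0 hF0),
    Submodule.map_mono (Ideal.mul_le.2 fun g hg f hf => Submodule.mem_colon.1 (hGB hg) f hf)⟩, ?_⟩
  rw [mem_vSub] at hxF ⊢
  intro y hy
  refine hxF y ?_
  rw [mem_one_div_coeI] at hy ⊢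
  intro f hf
  have : G ≤ denomIdeal (algebraMap D (FractionRing D) f * y) := by
    intro g hg
    obtain ⟨e, he⟩ := mem_denomIdeal.1 (hy (Ideal.mul_mem_mul hg hf))
    exact mem_denomIdeal.2 ⟨e, by rw [he, map_mul, mul_assoc]⟩
  obtain ⟨e, he⟩ := mem_denomIdeal.1 (hG1 _ this)
  exact mem_denomIdeal.2 ⟨e, by rw [he, map_one, one_mul]⟩

end TOperation

theorem statement11 (D : Type*) [CommRing D] [IsDomain D]
    (hPvMD : IsPvMD D)
    (hsharp : ∀ M : Ideal D, IsTMax D M → IsTSharp D M)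
    (I : Ideal D) (hI : I ≠ ⊥)
    (hinv : (1 : Submodule D (FractionRing D)) / coeI D I = 1) :
    TIdem D I := by
  exact .of_forall_exists_mul_mem hI fun M hM _ ha =>
    (hsharp M hM).exists_mul_mem hPvMD hM hinv ha

end
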